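/- Let s ≥ 4 be an integer and let G be a finite simple connected graph such that: (1) every vertex of G has degree at least 2 and at most s, and for every edge e of G the graph G − e has a vertex of degree less than 2 (i.e., G is minimal in the class of graphs with all degrees between 2 and s); (2) λ(G) < v(G)/(s+1); and (3) every graph G' with all vertex degrees between 2 and s and with v(G') < v(G) satisfies λ(G') ≥ v(G')/(s+1). Then every thread of G has exactly 3 edges. -/

import Mathlib

/-- `H` is a path with `k` edges (a "k-edge path"), as a subgraph of `G`. -/
def SimpleGraph.Subgraph.IsKEdgePath {V : Type*} {G : SimpleGraph V}
    (H : G.Subgraph) (k : ℕ) : Prop :=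
  ∃ (u v : V) (w : G.Walk u v), w.IsPath ∧ w.length = k ∧ H = w.toSubgraph

/-- `H` is a tree with `k` edges (a "k-edge tree"), as a subgraph of `G`. -/
def SimpleGraph.Subgraph.IsKEdgeTree {V : Type*} {G : SimpleGraph V}
    (H : G.Subgraph) (k : ℕ) : Prop :=
  H.coe.IsTree ∧ H.edgeSet.ncard = k

/-- The maximum number of pairwise vertex-disjoint `k`-edge paths in `G`. -/
noncomputable def SimpleGraph.lambdaK {V : Type*} (G : SimpleGraph V) (k : ℕ) : ℕ :=
  sSup {n | ∃ P : Finset G.Subgraph,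
    (∀ H ∈ P, H.IsKEdgePath k) ∧
    (P : Set G.Subgraph).Pairwise (fun H H' => Disjoint H.verts H'.verts) ∧
    P.card = n}

/-- The maximum number of pairwise vertex-disjoint `k`-edge trees in `G`. -/
noncomputable def SimpleGraph.tauK {V : Type*} (G : SimpleGraph V) (k : ℕ) : ℕ :=
  sSup {n | ∃ P : Finset G.Subgraph,
    (∀ H ∈ P, H.IsKEdgeTree k) ∧
    (P : Set G.Subgraph).Pairwise (fun H H' => Disjoint H.verts H'.verts) ∧
    P.card = n}

/-- A path-thread of `G`: a maximal path in `G` such that every vertex having degree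
two in the path also has degree two in `G`. -/
def SimpleGraph.IsPathThread {V : Type*} (G : SimpleGraph V) {x y : V}
    (w : G.Walk x y) : Prop :=
  w.IsPath ∧
  (∀ v : V, (w.toSubgraph.neighborSet v).ncard = 2 → (G.neighborSet v).ncard = 2) ∧
  ∀ (x' y' : V) (w' : G.Walk x' y'), w'.IsPath →
    (∀ v : V, (w'.toSubgraph.neighborSet v).ncard = 2 → (G.neighborSet v).ncard = 2) →
    w.toSubgraph ≤ w'.toSubgraph → w.toSubgraph = w'.toSubgraph

/-- A thread of `G` with end-vertices `x` and `y` (possibly `x = y`): either a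
path-thread, or (when `y = x`) a cycle-thread, i.e. a cycle all of whose vertices
except the distinguished vertex `x` have degree two in `G`. -/
def SimpleGraph.IsThread {V : Type*} (G : SimpleGraph V) {x y : V}
    (w : G.Walk x y) : Prop :=
  G.IsPathThread w ∨
  ∃ h : y = x, (w.copy rfl h).IsCycle ∧
    ∀ v ∈ w.support, v ≠ x → (G.neighborSet v).ncard = 2

open SimpleGraph in
/-- a packing of `n` disjoint 2-edge paths inside `S`. -/
inductive Pk {V : Type} (G : SimpleGraph V) : Set V → ℕ → Prop
  | nil (T : Set V) : Pk G T 0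
  | cons {S T : Set V} {n : ℕ} {a b c : V} : Pk G S n → G.Adj a b → G.Adj b c → a ≠ c →
      a ∉ S → b ∉ S → c ∉ S → S ⊆ T → a ∈ T → b ∈ T → c ∈ T → Pk G T (n + 1)

theorem Pk.mono {V : Type} {G : SimpleGraph V} {S T : Set V} {n : ℕ} (h : Pk G S n)
    (hST : S ⊆ T) : Pk G T n := by
  cases h with
  | nil => exact Pk.nil T
  | cons h h1 h2 h3 h4 h5 h6 h7 h8 h9 h10 =>
    exact Pk.cons h h1 h2 h3 h4 h5 h6 (h7.trans hST) (hST h8) (hST h9) (hST h10)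

theorem Pk.add {V : Type} {G : SimpleGraph V} {S : Set V} {m : ℕ}
    (h : Pk G S m) : ∀ {T : Set V} {n : ℕ}, Pk G T n → Disjoint S T → Pk G (S ∪ T) (m + n) := by
  induction h with
  | nil S =>
    intro T n h hd
    simpa using h.mono Set.subset_union_right
  | @cons S T m a b c h h1 h2 h3 h4 h5 h6 h7 h8 h9 h10 ih =>
    intro U n hU hd
    have h' := ih hU (hd.mono_left h7)
    have hx : ∀ x ∈ T, x ∉ U := fun x hx hxU => Set.disjoint_left.1 hd hx hxU
    have : m + 1 + n = (m + n) + 1 := by omega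
    rw [this]
    refine Pk.cons h' h1 h2 h3 ?_ ?_ ?_ (Set.union_subset_union_left _ h7) (Or.inl h8)
      (Or.inl h9) (Or.inl h10)
    · rintro (h | h); exacts [h4 h, hx _ h8 h]
    · rintro (h | h); exacts [h5 h, hx _ h9 h]
    · rintro (h | h); exacts [h6 h, hx _ h10 h]

theorem Pk.of_induce {V : Type} {G : SimpleGraph V} {A : Set V} {S : Set A} {n : ℕ}
    (h : Pk (G.induce A) S n) : Pk G (Subtype.val '' S) n := by
  induction h with
  | nil T => exact Pk.nil _
  | @cons S T m a b c h h1 h2 h3 h4 h5 h6 h7 h8 h9 h10 ih =>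
    refine Pk.cons (a := a.1) (b := b.1) (c := c.1) ih h1 h2 ?_ ?_ ?_ ?_ (Set.image_mono h7)
      ⟨_, h8, rfl⟩ ⟨_, h9, rfl⟩ ⟨_, h10, rfl⟩
    · simpa [Subtype.ext_iff] using h3
    · simpa using h4
    · simpa using h5
    · simpa using h6

theorem Pk.of_list {V : Type} {G : SimpleGraph V} : ∀ (n : ℕ) (L : List V), L.length = n →
    L.Nodup → L.IsChain G.Adj → Pk G {x | x ∈ L} (L.length / 3) := by
  intro n
  induction n using Nat.strong_induction_on with
  | _ n ih =>
    intro L hn hnd hc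
    match L, hn, hnd, hc with
    | [], _, _, _ => simpa using Pk.nil _
    | [_], _, _, _ => simpa using Pk.nil _
    | [_, _], _, _, _ => simpa using Pk.nil _
    | a :: b :: c :: L, hn, hnd, hc =>
      have hc' : L.IsChain G.Adj := by
        have := hc.tail.tail.tail
        simpa using this
      simp only [List.nodup_cons, List.mem_cons, not_or] at hnd
      have h := ih L.length (by simp at hn; omega) L rfl hnd.2.2.2 hc'
      have : (a :: b :: c :: L).length / 3 = L.length / 3 + 1 := by
        simp; omega
      rw [this]
      have h1 : G.Adj a b := by
        simp only [List.isChain_cons_cons] at hc; exact hc.1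
      have h2 : G.Adj b c := by
        simp only [List.isChain_cons_cons] at hc; exact hc.2.1
      refine Pk.cons h h1 h2 (by tauto) (by simp; tauto) (by simp; tauto) (by simp; tauto) ?_
        (by simp) (by simp) (by simp)
      intro x hx
      simp at hx ⊢
      tauto

theorem lam_bdd {V : Type} [Fintype V] (G : SimpleGraph V) : BddAbove {n | ∃ P : Finset G.Subgraph,
    (∀ H ∈ P, H.IsKEdgePath 2) ∧
    (P : Set G.Subgraph).Pairwise (fun H H' => Disjoint H.verts H'.verts) ∧
    P.card = n} := by
  classical
  have : Fintype G.Subgraph := Fintype.ofFinite _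
  refine ⟨Fintype.card G.Subgraph, ?_⟩
  rintro n ⟨P, -, -, rfl⟩
  exact Finset.card_le_univ P

theorem Pk.to_finset {V : Type} {G : SimpleGraph V} {S : Set V} {n : ℕ} (h : Pk G S n) :
    ∃ P : Finset G.Subgraph, (∀ H ∈ P, H.IsKEdgePath 2) ∧
    (P : Set G.Subgraph).Pairwise (fun H H' => Disjoint H.verts H'.verts) ∧
    P.card = n ∧ ∀ H ∈ P, H.verts ⊆ S := by
  classical
  induction h with
  | nil T => exact ⟨∅, by simp⟩
  | @cons S T m a b c h h1 h2 h3 h4 h5 h6 h7 h8 h9 h10 ih =>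
    obtain ⟨P, p1, p2, p3, p4⟩ := ih
    let w : G.Walk a c := .cons h1 (.cons h2 .nil)
    have hv : w.toSubgraph.verts = {a, b, c} := by
      ext x; simp [w]; tauto
    have hd : ∀ H ∈ P, Disjoint w.toSubgraph.verts H.verts := by
      intro H hH
      rw [Set.disjoint_left, hv]
      intro x hx hx'
      have := p4 H hH hx'
      simp at hx
      rcases hx with rfl | rfl | rfl <;> contradiction
    have hn : w.toSubgraph ∉ P := by
      intro hw
      have := p4 _ hw (show a ∈ w.toSubgraph.verts by simp)
      exact h4 this
    refine ⟨insert w.toSubgraph P, ?_, ?_, ?_, ?_⟩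
    · intro H hH
      rcases Finset.mem_insert.1 hH with rfl | hH
      · refine ⟨a, c, w, ?_, rfl, rfl⟩
        simp [w, SimpleGraph.Walk.cons_isPath_iff, h1.ne, h2.ne, h3]
      · exact p1 H hH
    · rw [Finset.coe_insert, Set.pairwise_insert]
      refine ⟨p2, fun H hH _ => ⟨hd H hH, (hd H hH).symm⟩⟩
    · rw [Finset.card_insert_of_notMem hn, p3]
    · intro H hH
      rcases Finset.mem_insert.1 hH with rfl | hH
      · rw [hv]; rintro x (rfl | rfl | rfl) <;> assumption
      · exact (p4 H hH).trans h7

theorem Pk.le_lam {V : Type} [Fintype V] {G : SimpleGraph V} {S : Set V} {n : ℕ} (h : Pk G S n) :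
    n ≤ G.lambdaK 2 := by
  obtain ⟨P, p1, p2, p3, -⟩ := h.to_finset
  exact le_csSup (lam_bdd G) ⟨P, p1, p2, p3⟩

theorem Pk.lam {V : Type} [Fintype V] (G : SimpleGraph V) : Pk G Set.univ (G.lambdaK 2) := by
  classical
  have hne : {n | ∃ P : Finset G.Subgraph,
    (∀ H ∈ P, H.IsKEdgePath 2) ∧
    (P : Set G.Subgraph).Pairwise (fun H H' => Disjoint H.verts H'.verts) ∧
    P.card = n}.Nonempty := ⟨0, ∅, by simp⟩
  obtain ⟨P, p1, p2, p3⟩ := Nat.sSup_mem hne (lam_bdd G)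
  have key : ∀ Q : Finset G.Subgraph, Q ⊆ P → Pk G (⋃ H ∈ Q, H.verts) Q.card := by
    intro Q
    induction Q using Finset.induction_on with
    | empty => intro _; exact Pk.nil _
    | insert H Q hH ih =>
      intro hQ
      have hQ' : Q ⊆ P := fun x hx => hQ (Finset.mem_insert_of_mem hx)
      have hHP : H ∈ P := hQ (Finset.mem_insert_self _ _)
      obtain ⟨u, v, w, hw, hl, rfl⟩ := p1 H hHP
      rw [Finset.card_insert_of_notMem hH]
      match w, hw, hl with
      | .cons (v := b) h1 (.cons h2 .nil), hw, hl =>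
        simp [SimpleGraph.Walk.cons_isPath_iff] at hw
        have hnot : ∀ x ∈ (SimpleGraph.Walk.cons h1 (.cons h2 .nil)).toSubgraph.verts,
            x ∉ ⋃ H ∈ Q, H.verts := by
          intro x hx hx'
          simp only [Set.mem_iUnion] at hx'
          obtain ⟨H', hH', hxH⟩ := hx'
          have := p2 hHP (hQ' hH') (by rintro rfl; exact hH hH')
          exact Set.disjoint_left.1 this hx hxH
        refine Pk.cons (ih hQ') h1 h2 (by tauto) (hnot _ ?_) (hnot _ ?_) (hnot _ ?_) ?_ ?_ ?_ ?_
        · simp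
        · simp
        · simp
        · intro x hx; simp at hx ⊢; tauto
        · simp
        · simp
        · simp
  have := (key P subset_rfl).mono (Set.subset_univ _)
  rw [p3] at this
  exact this

/-- invariant for deletable paths -/
def GoodL {V : Type} (G : SimpleGraph V) (L : List V) : Prop :=
  L.Nodup ∧ L.IsChain G.Adj ∧ 3 ≤ L.length ∧
  (∀ u ∈ L, ∀ w, w ∉ L → G.Adj u w → L.head? = some u ∨ L.getLast? = some u) ∧
  (∀ u ∈ L, ∀ w w', w ∉ L → w' ∉ L → G.Adj u w → G.Adj u w' → w = w')

theorem GoodL.rev {V : Type} {G : SimpleGraph V} {L : List V} (h : GoodL G L) :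
    GoodL G L.reverse := by
  obtain ⟨h1, h2, h3, h4, h5⟩ := h
  refine ⟨by simpa using h1, ?_, by simpa using h3, ?_, ?_⟩
  · rw [List.isChain_reverse]
    exact h2.imp (fun a b h => h.symm)
  · intro u hu w hw ha
    simp at hu hw ⊢
    exact (h4 u hu w hw ha).symm
  · simpa using h5

theorem GoodL.ext_head {V : Type} {G : SimpleGraph V} {L : List V} (h : GoodL G L) {u w : V}
    (hw : w ∉ L) (hu : L.head? = some u) (ha : G.Adj u w)
    (hout : ∀ x y, x ∉ L → y ∉ L → G.Adj w x → G.Adj w y → x = y) : GoodL G (w :: L) := by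
  obtain ⟨h1, h2, h3, h4, h5⟩ := h
  match L, hu with
  | u' :: L, hu =>
    simp at hu
    subst hu
    refine ⟨List.nodup_cons.2 ⟨hw, h1⟩, List.isChain_cons_cons.2 ⟨ha.symm, h2⟩, ?_, ?_, ?_⟩
    · simp at h3 ⊢; omega
    · intro v hv z hz hvz
      have hz' : z ∉ u' :: L := fun h => hz (List.mem_cons_of_mem _ h)
      rcases List.mem_cons.1 hv with rfl | hv
      · left; simp
      · rcases h4 v hv z hz' hvz with h | h
        · simp at h; subst h
          have := h5 u' (by simp) w z hw hz' ha hvz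
          subst this; simp at hz
        · right; rw [List.getLast?_cons_cons]; exact h
    · intro v hv z z' hz hz' a1 a2
      have hz1 : z ∉ u' :: L := fun h => hz (List.mem_cons_of_mem _ h)
      have hz2 : z' ∉ u' :: L := fun h => hz' (List.mem_cons_of_mem _ h)
      rcases List.mem_cons.1 hv with rfl | hv
      · exact hout _ _ hz1 hz2 a1 a2
      · exact h5 v hv _ _ hz1 hz2 a1 a2

theorem GoodL.step {V : Type} [Fintype V] {G : SimpleGraph V} {L : List V} (h : GoodL G L)
    (hdeg : ∀ v : V, 2 ≤ (G.neighborSet v).ncard) {w : V}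
    (hw : w ∉ L) (hout : (G.neighborSet w \ {x | x ∈ L}).ncard < 2) :
    ∃ L', GoodL G L' ∧ L.length < L'.length := by
  have hout' : ∀ x y, x ∉ L → y ∉ L → G.Adj w x → G.Adj w y → x = y := by
    intro x y hx hy ax ay
    have hle : (G.neighborSet w \ {x | x ∈ L}).ncard ≤ 1 := by omega
    exact (Set.ncard_le_one (Set.toFinite _)).1 hle x ⟨ax, hx⟩ y ⟨ay, hy⟩
  have : ∃ u ∈ L, G.Adj u w := by
    by_contra hcon
    push Not at hcon
    have : G.neighborSet w \ {x | x ∈ L} = G.neighborSet w := by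
      ext x
      simp only [Set.mem_sdiff, Set.mem_ofPred_eq, SimpleGraph.mem_neighborSet, and_iff_left_iff_imp]
      intro hx hxL
      exact hcon x hxL hx.symm
    rw [this] at hout
    have := hdeg w
    omega
  obtain ⟨u, hu, ha⟩ := this
  rcases h.2.2.2.1 u hu w hw ha with hh | hh
  · exact ⟨_, h.ext_head hw hh ha hout', by simp⟩
  · refine ⟨_, h.rev.ext_head (u := u) (w := w) (by simpa using hw) (by simpa using hh) ha ?_, by simp⟩
    simpa using hout'

theorem GoodL.absurd {V : Type} [Fintype V] (s : ℕ) (hs : 4 ≤ s)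
    (G : SimpleGraph V)
    (hdeg : ∀ v : V, 2 ≤ (G.neighborSet v).ncard ∧ (G.neighborSet v).ncard ≤ s)
    (hlam : (G.lambdaK 2 : ℚ) < (Fintype.card V : ℚ) / (s + 1))
    (hsmaller : ∀ (V' : Type) [Fintype V'] (G' : SimpleGraph V'),
      (∀ v : V', 2 ≤ (G'.neighborSet v).ncard ∧ (G'.neighborSet v).ncard ≤ s) →
      Fintype.card V' < Fintype.card V →
      (G'.lambdaK 2 : ℚ) ≥ (Fintype.card V' : ℚ) / (s + 1))
    (L0 : List V) (h0 : GoodL G L0) : False := by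
  classical
  by_cases hex : ∀ L, GoodL G L → ∃ L', GoodL G L' ∧ L.length < L'.length
  · have : ∀ n : ℕ, ∃ L, GoodL G L ∧ n ≤ L.length := by
      intro n
      induction n with
      | zero => exact ⟨L0, h0, by simp⟩
      | succ n ih =>
        obtain ⟨L, hL, hn⟩ := ih
        obtain ⟨L', hL', hn'⟩ := hex L hL
        exact ⟨L', hL', by omega⟩
    obtain ⟨L, hL, hn⟩ := this (Fintype.card V + 1)
    have := hL.1.length_le_card
    omega
  push Not at hex
  obtain ⟨L, hL, hmax⟩ := hex
  let A : Set V := {x | x ∉ L}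
  have himg : ∀ v : A, Subtype.val '' ((G.induce A).neighborSet v) = G.neighborSet v.1 \ {x | x ∈ L} := by
    intro v
    ext x
    simp [A]
  have hcard : Fintype.card A + L.length = Fintype.card V := by
    have h1 : Fintype.card A = (Finset.univ \ L.toFinset).card := by
      rw [Fintype.card_subtype]
      congr 1
      ext x; simp [A]
    have h2 : (Finset.univ \ L.toFinset).card + L.toFinset.card = Fintype.card V := by
      rw [Finset.card_sdiff_add_card_eq_card (Finset.subset_univ _), Finset.card_univ]
    rw [List.toFinset_card_of_nodup hL.1] at h2
    omega
  have hlen := hL.2.2.1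
  have key := hsmaller A (G.induce A) (by
    intro v
    rw [← Set.ncard_image_of_injective _ Subtype.val_injective, himg]
    constructor
    · by_contra hlt
      obtain ⟨L', hL', hl⟩ := hL.step (fun v => (hdeg v).1) v.2 (by omega)
      have := hmax L' hL'
      omega
    · exact (Set.ncard_le_ncard Set.sdiff_subset (Set.toFinite _)).trans (hdeg v).2) (by omega)
  have hp1 := (Pk.lam (G.induce A)).of_induce
  have hp2 := Pk.of_list (G := G) _ L rfl hL.1 hL.2.1
  have hp := (hp1.add hp2 (by
    rw [Set.disjoint_left]
    rintro x ⟨y, -, rfl⟩ hx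
    exact y.2 hx)).le_lam
  have hs1 : (0 : ℚ) < (s : ℚ) + 1 := by positivity
  rw [ge_iff_le, div_le_iff₀ hs1] at key
  rw [lt_div_iff₀ hs1] at hlam
  have key' : Fintype.card A ≤ (G.induce A).lambdaK 2 * (s + 1) := by exact_mod_cast key
  have hlam' : G.lambdaK 2 * (s + 1) < Fintype.card V := by exact_mod_cast hlam
  have h5 : L.length ≤ (L.length / 3) * 5 := by omega
  have h6 : (L.length / 3) * 5 ≤ (L.length / 3) * (s + 1) := Nat.mul_le_mul_left _ (by omega)
  have h7 := Nat.mul_le_mul_right (s + 1) hp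
  rw [Nat.add_mul] at h7
  omega

/-- potential -/
def phi (n : ℕ) : ℕ := if n = 0 then 0 else if n = 1 then 1 else 3

open Classical in
/-- number of vertices assigned to `b` -/
noncomputable def inn {V : Type} (D : Finset V) (f : V → V) (b : V) : ℕ :=
  (D.filter (fun d => f d = b)).card

/-- valid assignments -/
def Valid {V : Type} (G : SimpleGraph V) (B D : Finset V) (f : V → V) : Prop :=
  ∀ d ∈ D, G.Adj d (f d) ∧ f d ∈ B

/-- total potential -/
noncomputable def pot {V : Type} (B D : Finset V) (f : V → V) : ℕ :=
  ∑ b ∈ B, phi (inn D f b)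

/-- optimal assignments -/
def Opt {V : Type} (G : SimpleGraph V) (B D : Finset V) (f : V → V) : Prop :=
  Valid G B D f ∧ ∀ g, Valid G B D g → pot B D g ≤ pot B D f

open Classical in
theorem inn_update_new {V : Type} {D : Finset V} {f : V → V} {d b : V} (hd : d ∈ D)
    (hne : f d ≠ b) : inn D (Function.update f d b) b = inn D f b + 1 := by
  unfold inn
  rw [← Finset.card_insert_of_notMem (a := d) (by simp [hne])]
  congr 1
  ext x
  by_cases hx : x = d
  · subst hx; simp [hd]
  · simp [hx]

open Classical in
theorem inn_update_old {V : Type} {D : Finset V} {f : V → V} {d b : V} (hd : d ∈ D)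
    (hne : f d ≠ b) : inn D (Function.update f d b) (f d) + 1 = inn D f (f d) := by
  unfold inn
  rw [← Finset.card_insert_of_notMem (a := d) (by simp [hne.symm])]
  congr 1
  ext x
  by_cases hx : x = d
  · subst hx; simp [hd]
  · simp [hx]

open Classical in
theorem inn_update_other {V : Type} {D : Finset V} {f : V → V} {d b c : V}
    (hc : c ≠ b) (hc' : c ≠ f d) : inn D (Function.update f d b) c = inn D f c := by
  unfold inn
  congr 1
  ext x
  by_cases hx : x = d
  · subst hx; simp [hc.symm, hc'.symm]
  · simp [hx]

open Classical in
theorem pot_update {V : Type} {B D : Finset V} {f : V → V} {d b : V} (hd : d ∈ D)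
    (hne : f d ≠ b) (hb : b ∈ B) (hb' : f d ∈ B) :
    pot B D (Function.update f d b) + phi (inn D f b) + phi (inn D f (f d)) =
    pot B D f + phi (inn D f b + 1) + phi (inn D f (f d) - 1) := by
  unfold pot
  have hb'' : f d ∈ B.erase b := Finset.mem_erase.2 ⟨hne, hb'⟩
  rw [← Finset.add_sum_erase _ _ hb, ← Finset.add_sum_erase _ _ hb,
    ← Finset.add_sum_erase _ _ hb'', ← Finset.add_sum_erase _ _ hb'']
  rw [inn_update_new hd hne]
  have := inn_update_old hd hne
  have h2 : inn D (Function.update f d b) (f d) = inn D f (f d) - 1 := by omega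
  rw [h2]
  have h3 : ∑ x ∈ (B.erase b).erase (f d), phi (inn D (Function.update f d b) x) =
      ∑ x ∈ (B.erase b).erase (f d), phi (inn D f x) := by
    apply Finset.sum_congr rfl
    intro x hx
    simp only [Finset.mem_erase] at hx
    rw [inn_update_other hx.2.1 hx.1]
  rw [h3]
  omega

open Classical in
theorem valid_update {V : Type} {G : SimpleGraph V} {B D : Finset V} {f : V → V} {d b : V}
    (hf : Valid G B D f) (hb : b ∈ B) (ha : G.Adj d b) : Valid G B D (Function.update f d b) := by
  intro x hx
  by_cases h : x = d
  · subst h; simp [ha, hb]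
  · simpa [h] using hf x hx

theorem inn_pos {V : Type} {D : Finset V} {f : V → V} {d : V} (hd : d ∈ D) :
    1 ≤ inn D f (f d) := by
  classical
  unfold inn
  exact Finset.card_pos.2 ⟨d, by simp [hd]⟩

theorem opt_one {V : Type} {G : SimpleGraph V} {B D : Finset V} {f : V → V} {d b : V}
    (hf : Opt G B D f) (hd : d ∈ D) (hb : b ∈ B) (ha : G.Adj d b) (hne : f d ≠ b)
    (hbad : inn D f b ≤ 1) : inn D f (f d) = 2 ∨ (inn D f b = 0 ∧ inn D f (f d) = 1) := by
  classical
  have h1 := hf.2 _ (valid_update hf.1 hb ha)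
  have h2 := pot_update hd hne hb (hf.1 d hd).2
  have h3 := inn_pos (f := f) hd
  by_contra hcon
  push Not at hcon
  obtain ⟨c1, c2⟩ := hcon
  generalize inn D f (f d) = k at *
  generalize inn D f b = m at *
  unfold phi at h2
  split_ifs at h2 <;> omega

theorem inn_one_eq {V : Type} {D : Finset V} {f : V → V} {d e b : V} (hd : d ∈ D) (he : e ∈ D)
    (h1 : f d = b) (h2 : f e = b) (hi : inn D f b ≤ 1) : d = e := by
  classical
  unfold inn at hi
  exact Finset.card_le_one.1 hi d (by simp [hd, h1]) e (by simp [he, h2])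

theorem opt_two {V : Type} {G : SimpleGraph V} {B D : Finset V} {f : V → V} {d e b : V}
    (hf : Opt G B D f) (hd : d ∈ D) (he : e ∈ D) (hb : b ∈ B) (had : G.Adj d b) (hae : G.Adj e b)
    (hned : f d ≠ b) (hnee : f e ≠ b)
    (hbad : inn D f b = 0) (h1 : inn D f (f d) = 1) (h2 : inn D f (f e) = 1) : d = e := by
  classical
  by_contra hde
  have hfne : f e ≠ f d := fun h => hde (inn_one_eq hd he rfl h h1.le)
  have hv := valid_update hf.1 hb had
  have hp := pot_update hd hned hb (hf.1 d hd).2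
  rw [hbad, h1] at hp
  simp only [phi] at hp
  have hg : Opt G B D (Function.update f d b) := by
    refine ⟨hv, fun g hg => ?_⟩
    have := hf.2 g hg
    simp at hp
    omega
  have hge : Function.update f d b e = f e := by
    simp [Ne.symm hde]
  have hnew := inn_update_new hd hned
  have hoth : inn D (Function.update f d b) (f e) = inn D f (f e) := inn_update_other hnee hfne
  have := opt_one hg he hb hae (by rw [hge]; exact hnee) (by omega)
  rw [hge, hoth] at this
  omega

theorem exists_opt {V : Type} [Fintype V] {G : SimpleGraph V} {B D : Finset V}
    (h : ∀ d ∈ D, ∃ b ∈ B, G.Adj d b) : ∃ f, Opt G B D f := by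
  classical
  have hv : ∃ f, Valid G B D f := by
    have : ∀ d : V, ∃ b : V, d ∈ D → G.Adj d b ∧ b ∈ B := by
      intro d
      by_cases hd : d ∈ D
      · obtain ⟨b, hb, ha⟩ := h d hd
        exact ⟨b, fun _ => ⟨ha, hb⟩⟩
      · exact ⟨d, fun h => absurd h hd⟩
    choose f hf using this
    exact ⟨f, hf⟩
  obtain ⟨f0, hf0⟩ := hv
  obtain ⟨f, hf, hmax⟩ := Finset.exists_max_image
    (Finset.univ.filter (fun f => Valid G B D f)) (pot B D) ⟨f0, by simp [hf0]⟩
  simp only [Finset.mem_filter, Finset.mem_univ, true_and] at hf hmax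
  exact ⟨f, hf, hmax⟩

theorem Pk.of_assign {V : Type} {G : SimpleGraph V} {B D : Finset V} {f : V → V}
    (hBD : Disjoint B D) (hf : Valid G B D f) : ∀ Q : Finset V, Q ⊆ B →
    (∀ b ∈ Q, 2 ≤ inn D f b) → Pk G {x | x ∈ Q ∨ (x ∈ D ∧ f x ∈ Q)} Q.card := by
  classical
  intro Q
  induction Q using Finset.induction_on with
  | empty => intro _ _; exact Pk.nil _
  | insert b Q hb ih =>
    intro hQ h2
    have ih' := ih (fun x hx => hQ (Finset.mem_insert_of_mem hx))
      (fun x hx => h2 x (Finset.mem_insert_of_mem hx))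
    have hbB : b ∈ B := hQ (Finset.mem_insert_self _ _)
    have h2b := h2 b (Finset.mem_insert_self _ _)
    unfold inn at h2b
    obtain ⟨a, ha, c, hc, hac⟩ := Finset.one_lt_card.1 (show 1 < _ from h2b)
    simp only [Finset.mem_filter] at ha hc
    have hnB : ∀ x ∈ D, x ∉ Q := fun x hx hxQ =>
      Finset.disjoint_left.1 hBD (hQ (Finset.mem_insert_of_mem hxQ)) hx
    have hbD : b ∉ D := Finset.disjoint_left.1 hBD hbB
    rw [Finset.card_insert_of_notMem hb]
    have haa := (hf a ha.1).1
    have hcc := (hf c hc.1).1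
    rw [ha.2] at haa
    rw [hc.2] at hcc
    refine Pk.cons ih' haa hcc.symm hac ?_ ?_ ?_ ?_ ?_ ?_ ?_
    · rintro (h | h)
      · exact hnB a ha.1 h
      · rw [ha.2] at h; exact hb h.2
    · rintro (h | h)
      · exact hb h
      · exact hbD h.1
    · rintro (h | h)
      · exact hnB c hc.1 h
      · rw [hc.2] at h; exact hb h.2
    · rintro x (h | h)
      · exact Or.inl (Finset.mem_insert_of_mem h)
      · exact Or.inr ⟨h.1, Finset.mem_insert_of_mem h.2⟩
    · exact Or.inr ⟨ha.1, by simp [ha.2]⟩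
    · exact Or.inl (by simp)
    · exact Or.inr ⟨hc.1, by simp [hc.2]⟩

theorem count_main {V : Type} [Fintype V] (s : ℕ) (hs : 4 ≤ s) (G : SimpleGraph V)
    (B D : Finset V) (hBD : Disjoint B D) (hun : B.card + D.card = Fintype.card V)
    (hB : ∀ b ∈ B, 3 ≤ (G.neighborSet b).ncard ∧ (G.neighborSet b).ncard ≤ s)
    (hD : ∀ d ∈ D, (G.neighborSet d).ncard = 2)
    (hBadj : ∀ b ∈ B, ∀ x, G.Adj b x → x ∈ D)
    (hDadj : ∀ d ∈ D, ∃ b ∈ B, G.Adj d b) :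
    Fintype.card V ≤ G.lambdaK 2 * (s + 1) := by
  classical
  obtain ⟨f, hf⟩ := exists_opt hDadj
  have hnb : ∀ b ∈ B, (D.filter (fun d => G.Adj d b)).card = (G.neighborSet b).ncard := by
    intro b hb
    rw [← Set.ncard_coe_finset]
    congr 1
    ext x
    simp only [Finset.coe_filter, Set.mem_ofPred_eq, SimpleGraph.mem_neighborSet]
    exact ⟨fun h => h.2.symm, fun h => ⟨hBadj b hb x h, h.symm⟩⟩
  have hle : ∀ b ∈ B, inn D f b ≤ s := by
    intro b hb
    refine le_trans ?_ (hB b hb).2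
    rw [← hnb b hb]
    unfold inn
    apply Finset.card_le_card
    intro x hx
    simp only [Finset.mem_filter] at hx ⊢
    refine ⟨hx.1, ?_⟩
    have := (hf.1 x hx.1).1
    rwa [hx.2] at this
  set Bd := B.filter (fun b => inn D f b ≤ 1) with hBd
  set E := B.filter (fun b => inn D f b = 2) with hE
  set Gd := B.filter (fun b => 2 ≤ inn D f b) with hGd
  set T := D.filter (fun d => inn D f (f d) = 2) with hT
  have hDsum : D.card = ∑ b ∈ B, inn D f b :=
    Finset.card_eq_sum_card_fiberwise (fun d hd => (hf.1 d hd).2)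
  have hTcard : T.card = E.card * 2 := by
    rw [Finset.card_eq_sum_card_fiberwise (f := f) (t := E)]
    · rw [Finset.sum_const_nat]
      intro b hb
      rw [hE, Finset.mem_filter] at hb
      rw [← hb.2]
      unfold inn
      congr 1
      ext x
      simp only [hT, Finset.mem_filter]
      constructor
      · rintro ⟨⟨h1, h2⟩, h3⟩; exact ⟨h1, h3⟩
      · rintro ⟨h1, h3⟩; exact ⟨⟨h1, by rw [h3]; exact hb.2⟩, h3⟩
    · intro d hd
      simp only [hT, Finset.coe_filter, Set.mem_ofPred_eq] at hd
      simp only [hE, Finset.coe_filter, Set.mem_ofPred_eq]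
      exact ⟨(hf.1 d hd.1).2, hd.2⟩
  have hdc : Bd.card * 2 ≤ T.card * 1 := by
    apply Finset.card_mul_le_card_mul (fun b d => G.Adj d b)
    · intro b hb
      rw [hBd, Finset.mem_filter] at hb
      have h3 : 3 ≤ (D.filter (fun d => G.Adj d b)).card := by
        rw [hnb b hb.1]; exact (hB b hb.1).1
      have hsplit := Finset.card_filter_add_card_filter_not
        (s := D.filter (fun d => G.Adj d b)) (fun d => inn D f (f d) = 2)
      have hone : ((D.filter (fun d => G.Adj d b)).filter (fun d => ¬ inn D f (f d) = 2)).card ≤ 1 := by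
        rw [Finset.card_le_one]
        intro d hd e he
        simp only [Finset.mem_filter] at hd he
        obtain ⟨⟨d1, d2⟩, d3⟩ := hd
        obtain ⟨⟨e1, e2⟩, e3⟩ := he
        by_cases hfd : f d = b
        · by_cases hfe : f e = b
          · exact inn_one_eq d1 e1 hfd hfe hb.2
          · have h0 := inn_pos (f := f) d1
            rw [hfd] at h0
            have := opt_one hf e1 hb.1 e2 hfe hb.2
            omega
        · have hq := opt_one hf d1 hb.1 d2 hfd hb.2
          by_cases hfe : f e = b
          · have h0 := inn_pos (f := f) e1
            rw [hfe] at h0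
            omega
          · have hq' := opt_one hf e1 hb.1 e2 hfe hb.2
            exact opt_two hf d1 e1 hb.1 d2 e2 hfd hfe (by omega) (by omega) (by omega)
      have heq : Finset.bipartiteAbove (fun b d => G.Adj d b) T b =
          (D.filter (fun d => G.Adj d b)).filter (fun d => inn D f (f d) = 2) := by
        ext x
        simp only [Finset.mem_bipartiteAbove, hT, Finset.mem_filter]
        tauto
      rw [heq]
      omega
    · intro d hd
      rw [hT, Finset.mem_filter] at hd
      have hsub : ((Finset.bipartiteBelow (fun b d => G.Adj d b) Bd d : Finset V) : Set V) ⊆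
          G.neighborSet d \ {f d} := by
        intro b hb
        simp only [Finset.mem_coe, Finset.mem_bipartiteBelow, hBd, Finset.mem_filter] at hb
        refine ⟨hb.2, ?_⟩
        rintro rfl
        omega
      have h1 := Set.ncard_le_ncard hsub (Set.toFinite _)
      rw [Set.ncard_coe_finset, Set.ncard_sdiff_singleton_of_mem
        (show f d ∈ G.neighborSet d from (hf.1 d hd.1).1), hD d hd.1] at h1
      exact h1
  have hpk := (Pk.of_assign hBD hf.1 Gd (Finset.filter_subset _ _)
    (fun b hb => (Finset.mem_filter.1 hb).2)).le_lam
  have hsum : ∑ b ∈ B, (1 + inn D f b + 2 * (if inn D f b = 2 then 1 else 0)) ≤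
      ∑ b ∈ B, (2 * (if inn D f b ≤ 1 then 1 else 0) +
        (s + 1) * (if 2 ≤ inn D f b then 1 else 0)) := by
    apply Finset.sum_le_sum
    intro b hb
    have := hle b hb
    split_ifs <;> omega
  simp only [Finset.sum_add_distrib, ← Finset.mul_sum, ← Finset.card_filter, Finset.sum_const,
    smul_eq_mul, mul_one] at hsum
  have hfin := Nat.mul_le_mul_right (s + 1) hpk
  rw [mul_comm Gd.card] at hfin
  have hsum' : B.card + ∑ b ∈ B, inn D f b + 2 * E.card ≤ 2 * Bd.card + (s + 1) * Gd.card := hsum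
  omega

theorem main_false {V : Type} [Fintype V] (s : ℕ) (hs : 4 ≤ s)
    (G : SimpleGraph V)
    (hdeg : ∀ v : V, 2 ≤ (G.neighborSet v).ncard ∧ (G.neighborSet v).ncard ≤ s)
    (hmin : ∀ e ∈ G.edgeSet, ∃ v : V, ((G.deleteEdges {e}).neighborSet v).ncard < 2)
    (hlam : (G.lambdaK 2 : ℚ) < (Fintype.card V : ℚ) / (s + 1))
    (hsmaller : ∀ (V' : Type) [Fintype V'] (G' : SimpleGraph V'),
      (∀ v : V', 2 ≤ (G'.neighborSet v).ncard ∧ (G'.neighborSet v).ncard ≤ s) →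
      Fintype.card V' < Fintype.card V →
      (G'.lambdaK 2 : ℚ) ≥ (Fintype.card V' : ℚ) / (s + 1)) : False := by
  classical
  set B : Finset V := Finset.univ.filter (fun v => ¬ (G.neighborSet v).ncard = 2) with hBdef
  set D : Finset V := Finset.univ.filter (fun v => (G.neighborSet v).ncard = 2) with hDdef
  have hun : B.card + D.card = Fintype.card V := by
    rw [add_comm, hBdef, hDdef, Finset.card_filter_add_card_filter_not, Finset.card_univ]
  have hcm : Fintype.card V ≤ G.lambdaK 2 * (s + 1) := by
    apply count_main s hs G B D _ hun
    · intro b hb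
      simp only [hBdef, Finset.mem_filter, Finset.mem_univ, true_and] at hb
      have := hdeg b
      omega
    · intro d hd
      simpa [hDdef] using hd
    · intro b hb x hbx
      by_contra hx
      simp only [hDdef, hBdef, Finset.mem_filter, Finset.mem_univ, true_and] at hx hb
      obtain ⟨v, hv⟩ := hmin s(b, x) hbx
      have hdel : ∀ u z : V, z ∈ G.neighborSet u → ¬ s(u, z) = s(b, x) →
          z ∈ (G.deleteEdges {s(b, x)}).neighborSet u := by
        intro u z hz hne
        simp only [SimpleGraph.mem_neighborSet, SimpleGraph.deleteEdges_adj,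
          Set.mem_singleton_iff]
        exact ⟨hz, hne⟩
      have hsub : ∃ t, G.neighborSet v \ {t} ⊆ (G.deleteEdges {s(b, x)}).neighborSet v ∧
          (G.neighborSet v).ncard ≠ 2 ∨ G.neighborSet v ⊆ (G.deleteEdges {s(b, x)}).neighborSet v := by
        by_cases hvb : v = b
        · subst hvb
          refine ⟨x, Or.inl ⟨?_, hb⟩⟩
          rintro z ⟨hz, hz'⟩
          apply hdel _ _ hz
          intro h
          have : z = x := by simp at h; grind
          exact hz' this
        · by_cases hvx : v = x
          · subst hvx
            refine ⟨b, Or.inl ⟨?_, hx⟩⟩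
            rintro z ⟨hz, hz'⟩
            apply hdel _ _ hz
            intro h
            rw [Sym2.eq_swap] at h
            have : z = b := by simp at h; grind
            exact hz' this
          · refine ⟨b, Or.inr ?_⟩
            intro z hz
            apply hdel _ _ hz
            intro h
            have : v ∈ s(b, x) := h ▸ Sym2.mem_mk_left v z
            simp at this
            tauto
      have hd := (hdeg v).1
      obtain ⟨t, ⟨h1, h2⟩ | h1⟩ := hsub
      · have h3 := Set.ncard_le_ncard h1 (Set.toFinite _)
        have h4 := Set.pred_ncard_le_ncard_sdiff_singleton (G.neighborSet v) t
        omega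
      · have h3 := Set.ncard_le_ncard h1 (Set.toFinite _)
        omega
    · intro d hd
      by_contra hcon
      push Not at hcon
      simp only [hDdef, Finset.mem_filter, Finset.mem_univ, true_and] at hd
      obtain ⟨a, c, hac, hN⟩ := Set.ncard_eq_two.1 hd
      have had : G.Adj d a := by
        have : a ∈ G.neighborSet d := by rw [hN]; simp
        exact this
      have hcd : G.Adj d c := by
        have : c ∈ G.neighborSet d := by rw [hN]; simp
        exact this
      have hdeg2 : ∀ z, G.Adj d z → (G.neighborSet z).ncard = 2 := by
        intro z hz
        by_contra h
        exact hcon z (by simp [hBdef, h]) hz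
      have huniq : ∀ z, G.Adj d z → ∀ w w', w ≠ d → w' ≠ d → G.Adj z w → G.Adj z w' → w = w' := by
        intro z hz w w' hw hw' h1 h2
        obtain ⟨p, q, hpq, hM⟩ := Set.ncard_eq_two.1 (hdeg2 z hz)
        have e1 : d ∈ G.neighborSet z := hz.symm
        have e2 : w ∈ G.neighborSet z := h1
        have e3 : w' ∈ G.neighborSet z := h2
        rw [hM] at e1 e2 e3
        simp only [Set.mem_insert_iff, Set.mem_singleton_iff] at e1 e2 e3
        grind
      have hdn : ∀ w, G.Adj d w → w = a ∨ w = c := by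
        intro w hw
        have : w ∈ G.neighborSet d := hw
        rw [hN] at this
        simpa using this
      apply GoodL.absurd s hs G hdeg hlam hsmaller [a, d, c]
      refine ⟨?_, ?_, by simp, ?_, ?_⟩
      · simp [hac, had.ne', hcd.ne]
      · simp [had.symm, hcd]
      · intro u hu w hw ha
        simp only [List.mem_cons, List.not_mem_nil, or_false, not_or] at hu hw
        rcases hu with rfl | rfl | rfl
        · simp
        · have := hdn w ha; tauto
        · simp
      · intro u hu w w' hw hw' h1 h2
        simp only [List.mem_cons, List.not_mem_nil, or_false, not_or] at hu hw hw'
        rcases hu with rfl | rfl | rfl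
        · exact huniq _ had _ _ hw.2.1 hw'.2.1 h1 h2
        · have := hdn w h1; tauto
        · exact huniq _ hcd _ _ hw.2.1 hw'.2.1 h1 h2
    · rw [Finset.disjoint_left]
      intro x hx hx'
      simp only [hDdef, hBdef, Finset.mem_filter, Finset.mem_univ, true_and] at hx hx'
      exact hx hx'
  have hs1 : (0 : ℚ) < (s : ℚ) + 1 := by positivity
  rw [lt_div_iff₀ hs1] at hlam
  have hlam' : G.lambdaK 2 * (s + 1) < Fintype.card V := by exact_mod_cast hlam
  omega

/-- Let `s ≥ 4` and let `G` be a finite simple connected graph such that: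
(1) every vertex of `G` has degree at least 2 and at most `s`, and deleting any
edge of `G` creates a vertex of degree less than 2 (minimality);
(2) `λ(G) < v(G)/(s+1)`; and
(3) every graph `G'` with all vertex degrees between 2 and `s` and fewer vertices
than `G` satisfies `λ(G') ≥ v(G')/(s+1)`.
Then every thread of `G` has exactly 3 edges. -/
theorem stmt_13 {V : Type} [Fintype V] (s : ℕ) (hs : 4 ≤ s)
    (G : SimpleGraph V) (hconn : G.Connected)
    (hdeg : ∀ v : V, 2 ≤ (G.neighborSet v).ncard ∧ (G.neighborSet v).ncard ≤ s)
    (hmin : ∀ e ∈ G.edgeSet, ∃ v : V, ((G.deleteEdges {e}).neighborSet v).ncard < 2)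
    (hlam : (G.lambdaK 2 : ℚ) < (Fintype.card V : ℚ) / (s + 1))
    (hsmaller : ∀ (V' : Type) [Fintype V'] (G' : SimpleGraph V'),
      (∀ v : V', 2 ≤ (G'.neighborSet v).ncard ∧ (G'.neighborSet v).ncard ≤ s) →
      Fintype.card V' < Fintype.card V →
      (G'.lambdaK 2 : ℚ) ≥ (Fintype.card V' : ℚ) / (s + 1)) :
    ∀ (x y : V) (w : G.Walk x y), G.IsThread w → w.length = 3 := by
  exact (main_false s hs G hdeg hmin hlam hsmaller).elim
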